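/- Let c be a real number with ν₄ < c ≤ √15/2, where ν₄ = √((75 + 21√15)/44), and let q_c(u,v) = −(1/35)(5u³ + 6u²v + 8uv² + 16v³) − (c/315)(35u⁴ + 40u³v + 48u²v² + 64uv³ + 128v⁴) − (1/693)(63u⁵ + 70u⁴v + 80u³v² + 96u²v³ + 128uv⁴ + 256v⁵). Then there exist t > 0, u ∈ ℝ, a point w > u solving the leading-edge system 2t + ∂_u q_c(u,w) = 0, ∂_v ∂_u q_c(u,w) = 0, ∂_v² ∂_u q_c(u,w) < 0, and a point v < u solving the trailing-edge system 6t + ∂_v q_c(u,v) + ∂_u q_c(u,v) = 0, ∂_v(∂_v q_c + ∂_u q_c)(u,v) = 0, ∂_v²(∂_v q_c + ∂_u q_c)(u,v) < 0, with the same t and u. That is, for these values of c the bifurcation diagram contains a leading-trailing edge: a leading edge and a trailing edge with the same (x,t) coordinates. -/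

import Mathlib

/-- The polynomial q_c(u,v) of equation (4.6). -/
noncomputable def qc (c u v : ℝ) : ℝ :=
  -(1 / 35) * (5 * u ^ 3 + 6 * u ^ 2 * v + 8 * u * v ^ 2 + 16 * v ^ 3) -
    c / 315 * (35 * u ^ 4 + 40 * u ^ 3 * v + 48 * u ^ 2 * v ^ 2 + 64 * u * v ^ 3 +
      128 * v ^ 4) -
    1 / 693 * (63 * u ^ 5 + 70 * u ^ 4 * v + 80 * u ^ 3 * v ^ 2 + 96 * u ^ 2 * v ^ 3 +
      128 * u * v ^ 4 + 256 * v ^ 5)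

/-- The trailing-edge polynomial P(z) = 6t + ∂_v q_c(u,z) + ∂_u q_c(u,z). -/
noncomputable def Ptrail (c t u : ℝ) : ℝ → ℝ := fun z =>
  6 * t + deriv (fun b => qc c u b) z + deriv (fun a => qc c a z) u

/-- The leading-edge polynomial L(z) = 2t + ∂_u q_c(u,z). -/
noncomputable def Llead (c t u : ℝ) : ℝ → ℝ := fun z =>
  2 * t + deriv (fun a => qc c a z) u

/-- ν₄ = √((75 + 21√15)/44). -/
noncomputable def nu4 : ℝ := Real.sqrt ((75 + 21 * Real.sqrt 15) / 44)

theorem hasDerivAt_quintic (a₀ a₁ a₂ a₃ a₄ a₅ x : ℝ) :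
    HasDerivAt (fun y : ℝ => a₀ + a₁ * y + a₂ * y ^ 2 + a₃ * y ^ 3 + a₄ * y ^ 4 + a₅ * y ^ 5)
      (a₁ + 2 * a₂ * x + 3 * a₃ * x ^ 2 + 4 * a₄ * x ^ 3 + 5 * a₅ * x ^ 4) x := by
  have h := (((((hasDerivAt_const x a₀).add ((hasDerivAt_id' x).const_mul a₁)).add
    ((hasDerivAt_pow 2 x).const_mul a₂)).add ((hasDerivAt_pow 3 x).const_mul a₃)).add
    ((hasDerivAt_pow 4 x).const_mul a₄)).add ((hasDerivAt_pow 5 x).const_mul a₅)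
  refine HasDerivAt.congr_deriv h ?_
  push_cast
  ring

/-- The partial derivative `∂_u q_c`. -/
noncomputable def qcU (c u v : ℝ) : ℝ :=
  -(15 * u ^ 2 + 12 * u * v + 8 * v ^ 2) / 35 -
    c / 315 * (140 * u ^ 3 + 120 * u ^ 2 * v + 96 * u * v ^ 2 + 64 * v ^ 3) -
    (315 * u ^ 4 + 280 * u ^ 3 * v + 240 * u ^ 2 * v ^ 2 + 192 * u * v ^ 3 + 128 * v ^ 4) / 693

/-- The mixed partial derivative `∂_v ∂_u q_c`. -/
noncomputable def qcUV (c u v : ℝ) : ℝ :=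
  -(12 * u + 16 * v) / 35 - c / 315 * (120 * u ^ 2 + 192 * u * v + 192 * v ^ 2) -
    (280 * u ^ 3 + 480 * u ^ 2 * v + 576 * u * v ^ 2 + 512 * v ^ 3) / 693

/-- The partial derivative `∂_v² ∂_u q_c`. -/
noncomputable def qcUVV (c u v : ℝ) : ℝ :=
  -16 / 35 - c / 315 * (192 * u + 384 * v) -
    (480 * u ^ 2 + 1152 * u * v + 1536 * v ^ 2) / 693

/-- The sum `∂_v q_c + ∂_u q_c`. -/
noncomputable def qcS (c u v : ℝ) : ℝ :=
  -(21 * u ^ 2 + 28 * u * v + 56 * v ^ 2) / 35 -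
    c / 315 * (180 * u ^ 3 + 216 * u ^ 2 * v + 288 * u * v ^ 2 + 576 * v ^ 3) -
    (385 * u ^ 4 + 440 * u ^ 3 * v + 528 * u ^ 2 * v ^ 2 + 704 * u * v ^ 3 + 1408 * v ^ 4) / 693

/-- The derivative `∂_v (∂_v q_c + ∂_u q_c)`. -/
noncomputable def qcSV (c u v : ℝ) : ℝ :=
  -(28 * u + 112 * v) / 35 - c / 315 * (216 * u ^ 2 + 576 * u * v + 1728 * v ^ 2) -
    (440 * u ^ 3 + 1056 * u ^ 2 * v + 2112 * u * v ^ 2 + 5632 * v ^ 3) / 693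

/-- The derivative `∂_v² (∂_v q_c + ∂_u q_c)`. -/
noncomputable def qcSVV (c u v : ℝ) : ℝ :=
  -112 / 35 - c / 315 * (576 * u + 3456 * v) -
    (1056 * u ^ 2 + 4224 * u * v + 16896 * v ^ 2) / 693

theorem hasDerivAt_qc_left (c u v : ℝ) : HasDerivAt (fun a => qc c a v) (qcU c u v) u := by
  convert hasDerivAt_quintic (-(16 / 35) * v ^ 3 - c / 315 * 128 * v ^ 4 - 256 / 693 * v ^ 5)
    (-(8 / 35) * v ^ 2 - c / 315 * 64 * v ^ 3 - 128 / 693 * v ^ 4)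
    (-(6 / 35) * v - c / 315 * 48 * v ^ 2 - 96 / 693 * v ^ 3)
    (-(5 / 35) - c / 315 * 40 * v - 80 / 693 * v ^ 2)
    (-(c / 315 * 35) - 70 / 693 * v) (-(63 / 693)) u using 1
  · funext a; simp only [qc]; ring
  · simp only [qcU]; ring

theorem hasDerivAt_qc_right (c u v : ℝ) :
    HasDerivAt (fun b => qc c u b) (qcS c u v - qcU c u v) v := by
  convert hasDerivAt_quintic (-(5 / 35) * u ^ 3 - c / 315 * 35 * u ^ 4 - 63 / 693 * u ^ 5)
    (-(6 / 35) * u ^ 2 - c / 315 * 40 * u ^ 3 - 70 / 693 * u ^ 4)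
    (-(8 / 35) * u - c / 315 * 48 * u ^ 2 - 80 / 693 * u ^ 3)
    (-(16 / 35) - c / 315 * 64 * u - 96 / 693 * u ^ 2)
    (-(c / 315 * 128) - 128 / 693 * u) (-(256 / 693)) v using 1
  · funext a; simp only [qc]; ring
  · simp only [qcU, qcS]; ring

theorem Llead_eq (c t u : ℝ) : Llead c t u = fun z => 2 * t + qcU c u z := by
  funext z
  simp only [Llead, (hasDerivAt_qc_left c u z).deriv]

theorem Ptrail_eq (c t u : ℝ) : Ptrail c t u = fun z => 6 * t + qcS c u z := by
  funext z
  simp only [Ptrail, (hasDerivAt_qc_left c u z).deriv, (hasDerivAt_qc_right c u z).deriv]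
  ring

theorem hasDerivAt_qcU (c u v : ℝ) : HasDerivAt (qcU c u) (qcUV c u v) v := by
  convert hasDerivAt_quintic (-(15 / 35) * u ^ 2 - c / 315 * 140 * u ^ 3 - 315 / 693 * u ^ 4)
    (-(12 / 35) * u - c / 315 * 120 * u ^ 2 - 280 / 693 * u ^ 3)
    (-(8 / 35) - c / 315 * 96 * u - 240 / 693 * u ^ 2)
    (-(c / 315 * 64) - 192 / 693 * u) (-(128 / 693)) 0 v using 1
  · funext a; simp only [qcU]; ring
  · simp only [qcUV]; ring

theorem hasDerivAt_qcUV (c u v : ℝ) : HasDerivAt (qcUV c u) (qcUVV c u v) v := by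
  convert hasDerivAt_quintic (-(12 / 35) * u - c / 315 * 120 * u ^ 2 - 280 / 693 * u ^ 3)
    (-(16 / 35) - c / 315 * 192 * u - 480 / 693 * u ^ 2)
    (-(c / 315 * 192) - 576 / 693 * u) (-(512 / 693)) 0 0 v using 1
  · funext a; simp only [qcUV]; ring
  · simp only [qcUVV]; ring

theorem hasDerivAt_qcS (c u v : ℝ) : HasDerivAt (qcS c u) (qcSV c u v) v := by
  convert hasDerivAt_quintic (-(21 / 35) * u ^ 2 - c / 315 * 180 * u ^ 3 - 385 / 693 * u ^ 4)
    (-(28 / 35) * u - c / 315 * 216 * u ^ 2 - 440 / 693 * u ^ 3)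
    (-(56 / 35) - c / 315 * 288 * u - 528 / 693 * u ^ 2)
    (-(c / 315 * 576) - 704 / 693 * u) (-(1408 / 693)) 0 v using 1
  · funext a; simp only [qcS]; ring
  · simp only [qcSV]; ring

theorem hasDerivAt_qcSV (c u v : ℝ) : HasDerivAt (qcSV c u) (qcSVV c u v) v := by
  convert hasDerivAt_quintic (-(28 / 35) * u - c / 315 * 216 * u ^ 2 - 440 / 693 * u ^ 3)
    (-(112 / 35) - c / 315 * 576 * u - 1056 / 693 * u ^ 2)
    (-(c / 315 * 1728) - 2112 / 693 * u) (-(5632 / 693)) 0 0 v using 1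
  · funext a; simp only [qcSV]; ring
  · simp only [qcSVV]; ring

theorem deriv_Llead (c t u : ℝ) : deriv (Llead c t u) = qcUV c u := by
  funext z
  rw [Llead_eq]
  exact ((hasDerivAt_qcU c u z).const_add _).deriv

theorem deriv_Ptrail (c t u : ℝ) : deriv (Ptrail c t u) = qcSV c u := by
  funext z
  rw [Ptrail_eq]
  exact ((hasDerivAt_qcS c u z).const_add _).deriv

theorem IsMaxOn.deriv_nonpos_of_lt {f : ℝ → ℝ} {a b x f' : ℝ} (h : IsMaxOn f (Set.Icc a b) x)
    (hf : HasDerivAt f f' x) (hx : x ∈ Set.Icc a b) (hxb : x < b) : f' ≤ 0 := by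
  by_contra! hpos
  have h1 : ∀ᶠ y in nhdsWithin x (Set.Ioi x), 0 < slope f x y :=
    ((hasDerivAt_iff_tendsto_slope.1 hf).mono_left
      (nhdsWithin_mono x fun y hy => ne_of_gt hy)).eventually (lt_mem_nhds hpos)
  obtain ⟨y, hy, hy'⟩ := (h1.and (Ioo_mem_nhdsGT hxb)).exists
  have h2 : f y ≤ f x := h ⟨hx.1.trans hy'.1.le, hy'.2.le⟩
  rw [slope_def_field] at hy
  exact absurd hy (not_lt.2 (div_nonpos_of_nonpos_of_nonneg (by linarith) (by linarith [hy'.1])))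

theorem IsMaxOn.deriv_nonneg_of_gt {f : ℝ → ℝ} {a b x f' : ℝ} (h : IsMaxOn f (Set.Icc a b) x)
    (hf : HasDerivAt f f' x) (hx : x ∈ Set.Icc a b) (hax : a < x) : 0 ≤ f' := by
  by_contra! hneg
  have h1 : ∀ᶠ y in nhdsWithin x (Set.Iio x), slope f x y < 0 :=
    ((hasDerivAt_iff_tendsto_slope.1 hf).mono_left
      (nhdsWithin_mono x fun y hy => ne_of_lt hy)).eventually (gt_mem_nhds hneg)
  obtain ⟨y, hy, hy'⟩ := (h1.and (Ioo_mem_nhdsLT hax)).exists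
  have h2 : f y ≤ f x := h ⟨hy'.1.le, hy'.2.le.trans hx.2⟩
  rw [slope_def_field] at hy
  exact absurd hy (not_lt.2 (div_nonneg_of_nonpos (by linarith) (by linarith [hy'.2])))

/-- If the maxima over compact sets of two continuous families compare in opposite ways at the
endpoints of an interval, then they agree at some interior parameter. -/
theorem exists_isMaxOn_eq {F G : ℝ → ℝ → ℝ} (hF : Continuous (Function.uncurry F))
    (hG : Continuous (Function.uncurry G)) {K L : Set ℝ} (hK : IsCompact K) (hL : IsCompact L)
    {a b y₀ z₀ : ℝ} (hab : a ≤ b) (hy₀ : y₀ ∈ K) (hz₀ : z₀ ∈ L)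
    (ha : ∀ z ∈ L, G a z < F a y₀) (hb : ∀ y ∈ K, F b y < G b z₀) :
    ∃ x ∈ Set.Ioo a b, ∃ y ∈ K, ∃ z ∈ L,
      IsMaxOn (F x) K y ∧ IsMaxOn (G x) L z ∧ F x y = G x z := by
  have key : ∀ {H : ℝ → ℝ → ℝ} {M : Set ℝ}, Continuous (Function.uncurry H) → IsCompact M →
      M.Nonempty → ∀ x, ∃ m ∈ M, sSup (H x '' M) = H x m ∧ IsMaxOn (H x) M m := by
    intro H M hH hM hne x
    obtain ⟨m, hm, h1, h2⟩ := hM.exists_sSup_image_eq_and_ge hne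
      (hH.comp (Continuous.prodMk_right x)).continuousOn
    exact ⟨m, hm, h1, fun y hy => h2 y hy⟩
  have cF := hK.continuous_sSup hF
  have cG := hL.continuous_sSup hG
  obtain ⟨x, hx, hx0⟩ := intermediate_value_Ioo' hab (cF.sub cG).continuousOn
    (show (0 : ℝ) ∈ _ by
      constructor
      · obtain ⟨y, hy, h1, -⟩ := key hF hK ⟨_, hy₀⟩ b
        obtain ⟨z, hz, h2, h3⟩ := key hG hL ⟨_, hz₀⟩ b
        have h4 : G b z₀ ≤ G b z := h3 hz₀
        change sSup (F b '' K) - sSup (G b '' L) < 0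
        rw [h1, h2]
        linarith [hb y hy]
      · obtain ⟨y, hy, h1, h3⟩ := key hF hK ⟨_, hy₀⟩ a
        obtain ⟨z, hz, h2, -⟩ := key hG hL ⟨_, hz₀⟩ a
        have h4 : F a y₀ ≤ F a y := h3 hy₀
        change 0 < sSup (F a '' K) - sSup (G a '' L)
        rw [h1, h2]
        linarith [ha z hz])
  obtain ⟨y, hy, h1, h3⟩ := key hF hK ⟨_, hy₀⟩ x
  obtain ⟨z, hz, h2, h4⟩ := key hG hL ⟨_, hz₀⟩ x
  refine ⟨x, hx, y, hy, z, hz, h3, h4, ?_⟩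
  change sSup (F x '' K) - sSup (G x '' L) = 0 at hx0
  rw [h1, h2] at hx0
  linarith

theorem continuous_uncurry_qcU (c : ℝ) :
    Continuous (Function.uncurry fun u w => 3 * qcU c u w) := by
  simp only [Function.uncurry_def, qcU]
  fun_prop

theorem continuous_uncurry_qcS (c : ℝ) : Continuous (Function.uncurry (qcS c)) := by
  unfold Function.uncurry qcS
  fun_prop

theorem qcU_neg {c u w : ℝ} (hc : c ^ 2 ≤ 15 / 4) (huw : u < w) : qcU c u w < 0 := by
  have hd : 0 < w - u := sub_pos.2 huw
  have key : -qcU c u w =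
      5 * (1 / 3 * ((u ^ 2 + 2 * c / 5 * u) + 2 / 5 * (2 * u * (w - u) + 2 * c / 5 * (w - u)) +
        8 / 35 * (w - u) ^ 2) ^ 2 + 4 / 175 * ((2 * u * (w - u) + 2 * c / 5 * (w - u)) +
        8 / 9 * (w - u) ^ 2) ^ 2 + 128 / 87318 * ((w - u) ^ 2) ^ 2) +
      (3 - 4 * c ^ 2 / 5) * (1 / 3 * (u + 2 / 5 * (w - u)) ^ 2 + 4 / 175 * (w - u) ^ 2) := by
    simp only [qcU]
    ring
  have h1 : 0 ≤ 3 - 4 * c ^ 2 / 5 := by linarith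
  have h2 : 0 < -qcU c u w := by
    rw [key]
    have h3 : 0 < 128 / 87318 * ((w - u) ^ 2) ^ 2 := by
      have := pow_pos hd 2
      positivity
    refine add_pos_of_pos_of_nonneg (mul_pos (by norm_num)
      (add_pos_of_nonneg_of_pos (by positivity) h3)) (mul_nonneg h1 (by positivity))
  linarith

theorem qcUV_left_pos {c u : ℝ} (h1 : 1.884 ≤ c) (h2 : c ≤ 1.937) (hu : -0.775 ≤ u)
    (hu' : u ≤ -0.2) : 0 < qcUV c u 0.1 := by
  simp only [qcUV]
  nlinarith [mul_nonneg (sub_nonneg.2 hu) (sub_nonneg.2 hu'), sq_nonneg (u + 0.5),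
    mul_nonneg (mul_nonneg (sub_nonneg.2 hu) (sub_nonneg.2 hu')) (sub_nonneg.2 h1),
    mul_nonneg (mul_nonneg (sub_nonneg.2 hu) (sub_nonneg.2 hu')) (sub_nonneg.2 h2),
    mul_nonneg (mul_nonneg (sub_nonneg.2 hu) (sub_nonneg.2 hu')) (sub_nonneg.2 hu),
    mul_nonneg (sub_nonneg.2 hu) (sub_nonneg.2 h1), mul_nonneg (sub_nonneg.2 hu) (sub_nonneg.2 h2),
    mul_nonneg (sub_nonneg.2 hu') (sub_nonneg.2 h1),
    mul_nonneg (sub_nonneg.2 hu') (sub_nonneg.2 h2)]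

theorem qcUV_right_neg {c u : ℝ} (h1 : 1.884 ≤ c) (h2 : c ≤ 1.937) (hu : -0.775 ≤ u) :
    qcUV c u 0.25 < 0 := by
  simp only [qcUV]
  nlinarith [sq_nonneg (u + 0.5), mul_nonneg (sub_nonneg.2 hu) (sub_nonneg.2 h1),
    mul_nonneg (sub_nonneg.2 hu) (sub_nonneg.2 h2),
    mul_nonneg (sq_nonneg (u + 0.5)) (sub_nonneg.2 hu),
    mul_nonneg (sq_nonneg (u + 0.5)) (sub_nonneg.2 h1)]

theorem qcUVV_neg {c u w : ℝ} (h1 : 1.884 ≤ c) (h2 : c ≤ 1.937) (hu : -0.775 ≤ u)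
    (hw : 0.1 ≤ w) : qcUVV c u w < 0 := by
  simp only [qcUVV]
  nlinarith [sq_nonneg (u + w), sq_nonneg (u + 2 * w),
    mul_nonneg (sub_nonneg.2 hu) (sub_nonneg.2 h1), mul_nonneg (sub_nonneg.2 hu) (sub_nonneg.2 h2),
    mul_nonneg (sub_nonneg.2 hw) (sub_nonneg.2 hu), mul_nonneg (sub_nonneg.2 hw) (sub_nonneg.2 h1)]

theorem qcSV_left_pos {c u : ℝ} (h1 : 1.884 ≤ c) (h2 : c ≤ 1.937) (hu : -0.775 ≤ u)
    (hu' : u ≤ -0.2) : 0 < qcSV c u (-0.9) := by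
  simp only [qcSV]
  nlinarith [mul_nonneg (sub_nonneg.2 hu) (sub_nonneg.2 hu'), sq_nonneg (u + 0.5),
    mul_nonneg (mul_nonneg (sub_nonneg.2 hu) (sub_nonneg.2 hu')) (sub_nonneg.2 h1),
    mul_nonneg (mul_nonneg (sub_nonneg.2 hu) (sub_nonneg.2 hu')) (sub_nonneg.2 h2),
    mul_nonneg (mul_nonneg (sub_nonneg.2 hu) (sub_nonneg.2 hu')) (sub_nonneg.2 hu),
    mul_nonneg (sub_nonneg.2 hu) (sub_nonneg.2 h1), mul_nonneg (sub_nonneg.2 hu) (sub_nonneg.2 h2),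
    mul_nonneg (sub_nonneg.2 hu') (sub_nonneg.2 h1),
    mul_nonneg (sub_nonneg.2 hu') (sub_nonneg.2 h2)]

theorem qcSV_right_neg {c u : ℝ} (h1 : 1.884 ≤ c) (h2 : c ≤ 1.937) (hu : -0.68 ≤ u)
    (hu' : u ≤ -0.2) : qcSV c u (-0.68) < 0 := by
  simp only [qcSV]
  nlinarith [mul_nonneg (sub_nonneg.2 hu) (sub_nonneg.2 hu'), sq_nonneg (u + 0.5),
    mul_nonneg (mul_nonneg (sub_nonneg.2 hu) (sub_nonneg.2 hu')) (sub_nonneg.2 h1),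
    mul_nonneg (mul_nonneg (sub_nonneg.2 hu) (sub_nonneg.2 hu')) (sub_nonneg.2 h2),
    mul_nonneg (mul_nonneg (sub_nonneg.2 hu) (sub_nonneg.2 hu')) (sub_nonneg.2 hu),
    mul_nonneg (sub_nonneg.2 hu) (sub_nonneg.2 h1), mul_nonneg (sub_nonneg.2 hu) (sub_nonneg.2 h2),
    mul_nonneg (sub_nonneg.2 hu') (sub_nonneg.2 h1),
    mul_nonneg (sub_nonneg.2 hu') (sub_nonneg.2 h2)]

theorem qcSVV_neg {c u v : ℝ} (h1 : 1.884 ≤ c) (h2 : c ≤ 1.937) (hu : -0.775 ≤ u)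
    (hu' : u ≤ -0.2) (hv : -0.9 ≤ v) (hv' : v ≤ -0.68) : qcSVV c u v < 0 := by
  simp only [qcSVV]
  nlinarith [mul_nonneg (sub_nonneg.2 hu) (sub_nonneg.2 hu'), sq_nonneg (u + 2 * v + 2),
    mul_nonneg (sub_nonneg.2 hu) (sub_nonneg.2 h1), mul_nonneg (sub_nonneg.2 hu) (sub_nonneg.2 h2),
    mul_nonneg (sub_nonneg.2 hu') (sub_nonneg.2 h1),
    mul_nonneg (sub_nonneg.2 hu') (sub_nonneg.2 h2), mul_nonneg (sub_nonneg.2 hv) (sub_nonneg.2 h1),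
    mul_nonneg (sub_nonneg.2 hv) (sub_nonneg.2 h2), mul_nonneg (sub_nonneg.2 hv') (sub_nonneg.2 h1),
    mul_nonneg (sub_nonneg.2 hv') (sub_nonneg.2 h2), mul_nonneg (sub_nonneg.2 hv) (sub_nonneg.2 hv'),
    mul_nonneg (sub_nonneg.2 hv) (sub_nonneg.2 hu), mul_nonneg (sub_nonneg.2 hv') (sub_nonneg.2 hu),
    mul_nonneg (sub_nonneg.2 hv) (sub_nonneg.2 hu'),
    mul_nonneg (sub_nonneg.2 hv') (sub_nonneg.2 hu')]

theorem qcSV_neg_of_le {c u v : ℝ} (h1 : 1.884 ≤ c) (h2 : c ≤ 1.937)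
    (hq : 10 * u ^ 2 + 6 * c * u + 3 < 0) (huv : u ≤ v) (hv' : v ≤ -0.68) : qcSV c u v < 0 := by
  have hdiag : qcSV c u u = -(4 / 3) * u * (10 * u ^ 2 + 6 * c * u + 3) := by
    simp only [qcSV]
    ring
  have h3 : qcSV c u u < 0 := by
    rw [hdiag]
    nlinarith
  have h4 : qcSV c u v - qcSV c u u = (v - u) * (-112 / 35 - c / 315 * (2304 * u + 1728 * v) -
      (8800 * u ^ 2 + 7744 * u * v + 5632 * v ^ 2) / 693) := by
    simp only [qcSV]
    ring
  have h5 : -112 / 35 - c / 315 * (2304 * u + 1728 * v) -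
      (8800 * u ^ 2 + 7744 * u * v + 5632 * v ^ 2) / 693 < 0 := by
    nlinarith [mul_nonneg (sub_nonneg.2 (huv.trans hv')) (sub_nonneg.2 hv'),
      sq_nonneg (u + 0.7), sq_nonneg (v + 0.7), sq_nonneg (u + v + 1.4)]
  nlinarith

theorem qcS_lt_qcU_right {c v : ℝ} (h1 : 1.884 ≤ c) (h2 : c ≤ 1.937) (hv : -0.9 ≤ v)
    (hv' : v ≤ -0.68) : qcS c (-0.2) v < 3 * qcU c (-0.2) 0.11 := by
  have hk : 0 ≤ (-2 - (-1.44 + 8.64 * v - 57.6 * v ^ 2 + 576 * v ^ 3)) := by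
    nlinarith [mul_nonneg (mul_self_nonneg v) (show 0 ≤ -v by linarith)]
  have hm := mul_nonneg hk (sub_nonneg.2 h2)
  simp only [qcS, qcU]
  nlinarith [sq_nonneg (v * (v + 0.837)), sq_nonneg (v + 0.837),
    mul_nonneg (sub_nonneg.2 hv) (sub_nonneg.2 hv'), sq_nonneg ((v + 0.837) * (v + 0.5)),
    mul_nonneg (sub_nonneg.2 hv) (sq_nonneg (v + 0.837)),
    mul_nonneg (sub_nonneg.2 hv') (sq_nonneg (v + 0.837))]

theorem three_mul_qcU_lt_qcS_self {c u w : ℝ} (hu : u < 0) (hw : 0 < w)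
    (hq : 10 * u ^ 2 + 6 * c * u + 3 = 0) (hK : 0 < 1000 * (u ^ 2) ^ 2 - 300 * u ^ 2 - 99) :
    3 * qcU c u w < qcS c u u := by
  obtain ⟨s, rfl⟩ : ∃ s, w = s * u := ⟨w / u, (div_mul_cancel₀ w hu.ne).symm⟩
  have hs : s < 0 := by nlinarith
  have h1 : 3 * qcU c u (s * u) - qcS c u u = u ^ 2 * (s - 1) ^ 2 *
      (-(128 * u ^ 2 / 231) * s ^ 2 + (32 / 105 - 640 * u ^ 2 / 693) * s +
        (8 / 21 - 80 * u ^ 2 / 99)) := by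
    have hcu : c * u = -(10 * u ^ 2 + 3) / 6 := by linarith
    have h : 3 * qcU c u (s * u) - qcS c u u = u ^ 2 *
        (-3 * (15 + 12 * s + 8 * s ^ 2) / 35 + 3 - (c * u) / 105 * (140 + 120 * s + 96 * s ^ 2 +
          64 * s ^ 3) + 4 * (c * u) - u ^ 2 * (315 + 280 * s + 240 * s ^ 2 + 192 * s ^ 3 +
          128 * s ^ 4) / 231 + 5 * u ^ 2) := by
      simp only [qcU, qcS]
      ring
    rw [h, hcu]
    ring
  have h2 : -(128 * u ^ 2 / 231) * s ^ 2 + (32 / 105 - 640 * u ^ 2 / 693) * s +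
      (8 / 21 - 80 * u ^ 2 / 99) < 0 := by
    have hu2 : 0 < u ^ 2 := sq_pos_of_neg hu
    generalize u ^ 2 = K at *
    have h3 : 4 * (128 * K / 231) * (-(128 * K / 231) * s ^ 2 + (32 / 105 - 640 * K / 693) * s +
      (8 / 21 - 80 * K / 99)) = -(2 * (128 * K / 231) * s - (32 / 105 - 640 * K / 693)) ^ 2 -
        (32 / 3465) ^ 2 * 11 * (1000 * K ^ 2 - 300 * K - 99) := by ring
    by_contra! h4
    have h5 : 0 ≤ 4 * (128 * K / 231) * (-(128 * K / 231) * s ^ 2 +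
      (32 / 105 - 640 * K / 693) * s + (8 / 21 - 80 * K / 99)) := by positivity
    nlinarith [sq_nonneg (2 * (128 * K / 231) * s - (32 / 105 - 640 * K / 693))]
  have h3 : 0 < u ^ 2 * (s - 1) ^ 2 :=
    mul_pos (sq_pos_of_neg hu) (sq_pos_of_neg (by linarith))
  have h4 := mul_neg_of_pos_of_neg h3 h2
  linarith

theorem exists_inflection {c : ℝ} (h0 : 0 < c) (h1 : (75 + 21 * Real.sqrt 15) / 44 < c ^ 2)
    (h2 : c ^ 2 ≤ 15 / 4) :
    ∃ u, -0.775 ≤ u ∧ u ≤ -0.7 ∧ 10 * u ^ 2 + 6 * c * u + 3 = 0 ∧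
      0 < 1000 * (u ^ 2) ^ 2 - 300 * u ^ 2 - 99 := by
  set r := Real.sqrt 15 with hr
  have hr2 : r ^ 2 = 15 := Real.sq_sqrt (by norm_num)
  have hr0 : 3.8729 < r := Real.lt_sqrt_of_sq_lt (by norm_num)
  set d := Real.sqrt (9 * c ^ 2 - 30) with hd
  have hd2 : d ^ 2 = 9 * c ^ 2 - 30 := Real.sq_sqrt (by linarith)
  have hd0 : 0 ≤ d := Real.sqrt_nonneg _
  have hc1 : 1.884 < c := lt_of_pow_lt_pow_left₀ 2 h0.le (by linarith)
  have hc2 : c ≤ 1.937 := (sq_le_sq₀ h0.le (by norm_num)).1 (by linarith)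
  have hd1 : 1.4 < d := lt_of_pow_lt_pow_left₀ 2 hd0 (by linarith)
  have hd3 : d ≤ 1.937 := (sq_le_sq₀ hd0 (by norm_num)).1 (by linarith)
  have hq : 10 * ((-3 * c - d) / 10) ^ 2 + 6 * c * ((-3 * c - d) / 10) + 3 = 0 := by
    linear_combination hd2 / 10
  refine ⟨(-3 * c - d) / 10, by linarith, by linarith, hq, ?_⟩
  have hu : (-3 * c - d) / 10 ≤ -0.7 := by linarith
  generalize (-3 * c - d) / 10 = u at *
  have hK : 0.49 ≤ u ^ 2 := by nlinarith
  have hsq : (10 * u ^ 2 + 3) ^ 2 = 36 * u ^ 2 * c ^ 2 := by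
    have : 10 * u ^ 2 + 3 = -(6 * c * u) := by linarith
    rw [this]
    ring
  generalize u ^ 2 = K at *
  have h3 : 0 < 11 * (10 * K + 3) ^ 2 - 9 * K * (75 + 21 * r) := by
    rw [hsq]
    nlinarith [mul_pos (show 0 < K by linarith) (sub_pos.2 h1)]
  have hr1 : r < 3.873 := lt_of_pow_lt_pow_left₀ 2 (by norm_num) (by rw [hr2]; norm_num)
  have h4 : 0 < (K - (15 + 9 * r) / 100) * (K - (9 * r - 15) / 110) := by
    nlinarith
  have h5 : 0 < K - (9 * r - 15) / 110 := by linarith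
  have h6 : 0 < K - (15 + 9 * r) / 100 := (pos_iff_pos_of_mul_pos h4).2 h5
  nlinarith [mul_pos h6 (show 0 < K - (15 - 9 * r) / 100 by linarith)]

/-- For ν₄ < c ≤ √15/2 the bifurcation diagram contains a leading-trailing edge: a point
    w > u solving the leading-edge system and a point v < u solving the trailing-edge
    system, with the same t > 0 and u. -/
theorem stmt14 (c : ℝ) (hc1 : nu4 < c) (hc2 : c ≤ Real.sqrt 15 / 2) :
    ∃ t u v w : ℝ, 0 < t ∧ u < w ∧ v < u ∧
      Llead c t u w = 0 ∧ deriv (Llead c t u) w = 0 ∧ deriv (deriv (Llead c t u)) w < 0 ∧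
      Ptrail c t u v = 0 ∧ deriv (Ptrail c t u) v = 0 ∧
      deriv (deriv (Ptrail c t u)) v < 0 := by
  have hr2 : Real.sqrt 15 ^ 2 = 15 := Real.sq_sqrt (by norm_num)
  have hr0 : 3.8729 < Real.sqrt 15 := Real.lt_sqrt_of_sq_lt (by norm_num)
  have h0 : 0 < c := (Real.sqrt_nonneg _).trans_lt hc1
  have hcl : (75 + 21 * Real.sqrt 15) / 44 < c ^ 2 := (Real.sqrt_lt' h0).1 hc1
  have hcu : c ^ 2 ≤ 15 / 4 := by nlinarith
  have h1 : 1.884 ≤ c := by nlinarith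
  have h2 : c ≤ 1.937 := by nlinarith
  obtain ⟨u₀, hu₀, hu₀', hq₀, hK⟩ := exists_inflection h0 hcl hcu
  obtain ⟨u, ⟨hul, hur⟩, v, hv, w, hw, hmv, hmw, heq⟩ :=
    exists_isMaxOn_eq (continuous_uncurry_qcS c) (continuous_uncurry_qcU c)
      (isCompact_Icc (a := (-0.9 : ℝ)) (b := -0.68)) (isCompact_Icc (a := (0.1 : ℝ)) (b := 0.25))
      (a := u₀) (b := -0.2) (y₀ := u₀) (z₀ := 0.11) (by linarith)
      ⟨by linarith, by linarith⟩ ⟨by norm_num, by norm_num⟩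
      (fun z hz => three_mul_qcU_lt_qcS_self (by linarith) (by linarith [hz.1]) hq₀ hK)
      (fun y hy => qcS_lt_qcU_right h1 h2 hy.1 hy.2)
  have hu : -0.775 ≤ u := by linarith
  have hu' : u ≤ -0.2 := hur.le
  have hdw := (hasDerivAt_qcU c u w).const_mul 3
  have hdv := hasDerivAt_qcS c u v
  have hw1 : 0.1 < w := by
    refine lt_of_le_of_ne hw.1 fun h => ?_
    have h3 := hmw.deriv_nonpos_of_lt hdw hw (by rw [← h]; norm_num)
    rw [← h] at h3
    linarith [qcUV_left_pos h1 h2 hu hu']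
  have hw2 : w < 0.25 := by
    refine lt_of_le_of_ne hw.2 fun h => ?_
    have h3 := hmw.deriv_nonneg_of_gt hdw hw hw1
    rw [h] at h3
    linarith [qcUV_right_neg h1 h2 hu]
  have hv1 : -0.9 < v := by
    refine lt_of_le_of_ne hv.1 fun h => ?_
    have h3 := hmv.deriv_nonpos_of_lt hdv hv (by rw [← h]; norm_num)
    rw [← h] at h3
    linarith [qcSV_left_pos h1 h2 hu hu']
  have hv3 := hmv.deriv_nonneg_of_gt hdv hv hv1
  have hvu : v < u ∧ v < -0.68 := by
    rcases le_or_gt u (-0.68) with h | h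
    · have h4 : v < u := by
        by_contra! huv
        have hq : 10 * u ^ 2 + 6 * c * u + 3 < 0 := by nlinarith
        linarith [qcSV_neg_of_le h1 h2 hq huv hv.2]
      exact ⟨h4, h4.trans_le h⟩
    · have h4 : v < -0.68 := by
        refine lt_of_le_of_ne hv.2 fun h5 => ?_
        rw [h5] at hv3
        linarith [qcSV_right_neg h1 h2 h.le hu']
      exact ⟨h4.trans h, h4⟩
  have hv4 := hmv.deriv_nonpos_of_lt hdv hv hvu.2
  have hw3 := hmw.deriv_nonneg_of_gt hdw hw hw1
  have hw4 := hmw.deriv_nonpos_of_lt hdw hw hw2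
  have huw : u < w := by linarith
  refine ⟨-qcU c u w / 2, u, v, w, by linarith [qcU_neg hcu huw], huw, hvu.1, ?_, ?_, ?_, ?_, ?_,
    ?_⟩
  · rw [Llead_eq]
    ring
  · rw [deriv_Llead]
    linarith
  · rw [deriv_Llead, (hasDerivAt_qcUV c u w).deriv]
    exact qcUVV_neg h1 h2 hu hw.1
  · rw [Ptrail_eq]
    simp only [heq]
    ring
  · rw [deriv_Ptrail]
    linarith
  · rw [deriv_Ptrail, (hasDerivAt_qcSV c u v).deriv]
    exact qcSVV_neg h1 h2 hu hu' hv.1 hv.2
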